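/- arXiv:2208.01764 — 2 statements merged into one kernel-verified Lean document; each statement's English description precedes it below -/
import Mathlib

section
/- Bound and absolute convergence. For all 0 ≤ a ≤ b ≤ 1, every k ∈ ℂ and every integer n ≥ 0, the integrand defining S_n^{(a,b)}(k) is integrable over the simplex {a ≤ y₁ ≤ ⋯ ≤ y_n ≤ b}, and |S_n^{(a,b)}(k)| ≤ (1/(2ⁿ n!)) ( ∫_a^b |σ'(ξ)|/σ(ξ) dξ )ⁿ · exp( |Im k| ∫_a^b dξ/σ(ξ) ). Consequently the series ∑_{n=0}^{∞} S_n^{(a,b)}(k) converges absolutely, with ∑_{n=0}^{∞} |S_n^{(a,b)}(k)| ≤ exp( (1/2) ∫_a^b |σ'(ξ)|/σ(ξ) dξ ) · exp( |Im k| ∫_a^b dξ/σ(ξ) ). -/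
open MeasureTheory Filter

noncomputable section

/-- Nodes of the simplex: `y₀ = a`, `y_{n+1} = b`, interior nodes from `y`. -/
def nodes (a b : ℝ) (n : ℕ) (y : Fin n → ℝ) (p : ℕ) : ℝ :=
  if h : 1 ≤ p ∧ p ≤ n then y ⟨p - 1, by omega⟩ else if p = 0 then a else b

/-- The ordered simplex `a ≤ y₁ ≤ ⋯ ≤ y_n ≤ b`. -/
def simplex (a b : ℝ) (n : ℕ) : Set (Fin n → ℝ) :=
  {y | Monotone y ∧ ∀ i, y i ∈ Set.Icc a b}

/-- The alternating phase `∑_{p=0}^{n} (−1)^p ∫_{y_p}^{y_{p+1}} dξ/σ(ξ)`. -/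
def phase (σ : ℝ → ℝ) (a b : ℝ) (n : ℕ) (y : Fin n → ℝ) : ℝ :=
  ∑ p ∈ Finset.range (n + 1),
    (-1 : ℝ) ^ p * ∫ ξ in (nodes a b n y p)..(nodes a b n y (p + 1)), 1 / σ ξ

/-- The integrand defining `S_n^{(a,b)}(k)`. -/
def Sintegrand (σ : ℝ → ℝ) (a b : ℝ) (n : ℕ) (k : ℂ) (y : Fin n → ℝ) : ℂ :=
  ((∏ p, deriv σ (y p) / σ (y p) : ℝ) : ℂ) * Complex.sin (k * ((phase σ a b n y : ℝ) : ℂ))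

/-- `S_n^{(a,b)}(k)`. -/
def S (σ : ℝ → ℝ) (a b : ℝ) (n : ℕ) (k : ℂ) : ℂ :=
  ((2 : ℂ) ^ n)⁻¹ * ∫ y in simplex a b n, Sintegrand σ a b n k y

/-- `Δ(k) = ∑_{n=0}^∞ S_n^{(0,1)}(k)`. -/
def Δfun (σ : ℝ → ℝ) (k : ℂ) : ℂ := ∑' n, S σ 0 1 n k

/-- `σ` is absolutely continuous on `[0,1]`: fundamental-theorem-of-calculus
characterization with integrable derivative. -/
def sigmaAC (σ : ℝ → ℝ) : Prop :=
  IntegrableOn (deriv σ) (Set.Icc 0 1) ∧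
    ∀ x ∈ Set.Icc (0 : ℝ) 1, σ x = σ 0 + ∫ t in (0 : ℝ)..x, deriv σ t

lemma Complex.norm_sin_le_exp_abs_im (z : ℂ) : ‖Complex.sin z‖ ≤ Real.exp |z.im| := by
  have h₁ : ‖Complex.exp (-z * Complex.I)‖ ≤ Real.exp |z.im| := by
    rw [Complex.norm_exp]
    simpa using le_abs_self z.im
  have h₂ : ‖Complex.exp (z * Complex.I)‖ ≤ Real.exp |z.im| := by
    rw [Complex.norm_exp]
    simpa using neg_le_abs z.im
  have h := norm_sub_le (Complex.exp (-z * Complex.I)) (Complex.exp (z * Complex.I))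
  rw [Complex.sin, norm_div, norm_mul, Complex.norm_I, Complex.norm_two]
  linarith

lemma isClosed_simplex (a b : ℝ) (n : ℕ) : IsClosed (simplex a b n) := by
  have h : simplex a b n = {y | Monotone y} ∩ Set.univ.pi fun _ => Set.Icc a b := by
    ext y
    simp only [simplex, Set.mem_ofPred_eq, Set.mem_inter_iff, Set.mem_univ_pi]
  rw [h]
  exact isClosed_monotone.inter (isClosed_set_pi fun _ _ => isClosed_Icc)

lemma simplex_subset_pi_Icc (a b : ℝ) (n : ℕ) :
    simplex a b n ⊆ Set.univ.pi fun _ => Set.Icc a b :=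
  fun _ hy i _ => hy.2 i

lemma volume_setOf_not_injective (n : ℕ) :
    volume {y : Fin n → ℝ | ¬ Function.Injective y} = 0 := by
  have hsub : {y : Fin n → ℝ | ¬ Function.Injective y} ⊆
      ⋃ i : Fin n, ⋃ j : Fin n, ⋃ _ : i ≠ j, {y | y i = y j} := by
    intro y hy
    simp only [Set.mem_ofPred_eq, Function.Injective, not_forall] at hy
    obtain ⟨i, j, hij, hne⟩ := hy
    simp only [Set.mem_iUnion]
    exact ⟨i, j, hne, hij⟩
  refine measure_mono_null hsub ?_
  simp only [measure_iUnion_null_iff]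
  intro i j hij
  let L : (Fin n → ℝ) →ₗ[ℝ] ℝ :=
    LinearMap.proj (R := ℝ) (φ := fun _ => ℝ) i - LinearMap.proj (R := ℝ) (φ := fun _ => ℝ) j
  have hL : {y : Fin n → ℝ | y i = y j} = (LinearMap.ker L : Set (Fin n → ℝ)) := by
    ext y
    simp [L, sub_eq_zero]
  rw [hL]
  refine Measure.addHaar_submodule _ _ fun htop => ?_
  have hmem : (Pi.single i 1 : Fin n → ℝ) ∈ LinearMap.ker L := htop ▸ Submodule.mem_top
  simp [L, hij.symm] at hmem

lemma integrableOn_prod_simplex {f : ℝ → ℝ} {a b : ℝ} (hf : IntegrableOn f (Set.Icc a b))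
    (n : ℕ) : IntegrableOn (fun y : Fin n → ℝ => ∏ p, f (y p))
      (Set.univ.pi fun _ => Set.Icc a b) := by
  rw [IntegrableOn, volume_pi, Measure.restrict_pi_pi]
  exact Integrable.fintype_prod fun _ => hf

/-- The cube is the union of the `n!` images of the simplex under permutations of coordinates. -/
lemma factorial_mul_setIntegral_simplex_prod_le {f : ℝ → ℝ} {a b : ℝ} (hf0 : ∀ x, 0 ≤ f x)
    (hf : IntegrableOn f (Set.Icc a b)) (n : ℕ) :
    n.factorial * ∫ y in simplex a b n, ∏ p, f (y p) ≤ (∫ x in Set.Icc a b, f x) ^ n := by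
  let e : Equiv.Perm (Fin n) → ((Fin n → ℝ) ≃ᵐ (Fin n → ℝ)) := fun π =>
    MeasurableEquiv.arrowCongr' π.symm (MeasurableEquiv.refl ℝ)
  have he : ∀ π y, e π y = y ∘ π := fun π y => rfl
  have hcube := integrableOn_prod_simplex hf n
  have hsub : ∀ π, e π ⁻¹' simplex a b n ⊆ Set.univ.pi fun _ => Set.Icc a b := by
    intro π y hy i _
    simpa [he] using hy.2 (π.symm i)
  have hmp : ∀ π, MeasurePreserving (e π) := fun π =>
    volume_preserving_arrowCongr' π.symm (MeasurableEquiv.refl ℝ) (MeasurePreserving.id _)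
  have hint : ∀ π, ∫ y in e π ⁻¹' simplex a b n, ∏ p, f (y p) =
      ∫ y in simplex a b n, ∏ p, f (y p) := by
    intro π
    rw [← (hmp π).setIntegral_preimage_emb (e π).measurableEmbedding
      (fun y => ∏ p, f (y p)) (simplex a b n)]
    refine integral_congr_ae (Eventually.of_forall fun y => ?_)
    exact (Equiv.prod_comp π fun p => f (y p)).symm
  have hdisj : Pairwise (Function.onFun (AEDisjoint volume) fun π => e π ⁻¹' simplex a b n) := by
    intro π τ hne
    refine measure_mono_null ?_ (volume_setOf_not_injective n)
    rintro y ⟨hπ, hτ⟩ hinj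
    have heq : y ∘ π = y ∘ τ := Tuple.unique_monotone hπ.1 hτ.1
    exact hne (Equiv.ext fun i => hinj (congrFun heq i))
  have hunion := integral_iUnion_ae (μ := volume) (f := fun y : Fin n → ℝ => ∏ p, f (y p))
    (fun π => ((isClosed_simplex a b n).measurableSet.preimage (e π).measurable).nullMeasurableSet)
    hdisj (hcube.mono_set (Set.iUnion_subset hsub))
  rw [tsum_fintype, Finset.sum_congr rfl fun π _ => hint π, Finset.sum_const, Finset.card_univ,
    Fintype.card_perm, Fintype.card_fin, nsmul_eq_mul] at hunion
  rw [← hunion]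
  refine (setIntegral_mono_set hcube
    (Eventually.of_forall fun y => Finset.prod_nonneg fun p _ => hf0 _)
    (Set.iUnion_subset hsub).eventuallyLE).trans_eq ?_
  rw [volume_pi, Measure.restrict_pi_pi, integral_fintype_prod_eq_pow, Fintype.card_fin]

lemma continuous_nodes (a b : ℝ) (n p : ℕ) : Continuous fun y => nodes a b n y p := by
  unfold nodes
  split_ifs
  · exact continuous_apply _
  · exact continuous_const
  · exact continuous_const

lemma nodes_zero (a b : ℝ) (n : ℕ) (y : Fin n → ℝ) : nodes a b n y 0 = a := by
  simp [nodes]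

lemma nodes_last (a b : ℝ) (n : ℕ) (y : Fin n → ℝ) : nodes a b n y (n + 1) = b := by
  simp [nodes]

lemma nodes_mem_Icc {a b : ℝ} (hab : a ≤ b) {n : ℕ} {y : Fin n → ℝ} (hy : y ∈ simplex a b n)
    (p : ℕ) : nodes a b n y p ∈ Set.Icc a b := by
  unfold nodes
  split_ifs
  · exact hy.2 _
  · exact Set.left_mem_Icc.2 hab
  · exact Set.right_mem_Icc.2 hab

lemma nodes_le_succ {a b : ℝ} (hab : a ≤ b) {n : ℕ} {y : Fin n → ℝ} (hy : y ∈ simplex a b n)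
    {p : ℕ} (hp : p ≤ n) : nodes a b n y p ≤ nodes a b n y (p + 1) := by
  rcases Nat.eq_zero_or_pos p with rfl | hpos
  · rw [nodes_zero]
    exact (nodes_mem_Icc hab hy 1).1
  rcases hp.eq_or_lt with rfl | hlt
  · rw [nodes_last]
    exact (nodes_mem_Icc hab hy p).2
  · rw [nodes, nodes, dif_pos ⟨hpos, hp⟩, dif_pos ⟨by omega, by omega⟩]
    exact hy.1 (Fin.mk_le_mk.2 (by omega))

lemma continuousOn_phase {σ : ℝ → ℝ} {a b : ℝ} (hab : a ≤ b)
    (hσ : IntegrableOn (fun ξ => 1 / σ ξ) (Set.Icc a b)) (n : ℕ) :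
    ContinuousOn (phase σ a b n) (simplex a b n) := by
  have hprim : ContinuousOn (fun x => ∫ ξ in a..x, 1 / σ ξ) (Set.Icc a b) := by
    rw [← Set.uIcc_of_le hab] at hσ ⊢
    exact intervalIntegral.continuousOn_primitive_interval hσ
  have hnode : ∀ p, ContinuousOn (fun y => ∫ ξ in a..nodes a b n y p, 1 / σ ξ)
      (simplex a b n) := fun p =>
    hprim.comp (continuous_nodes a b n p).continuousOn fun _ hy => nodes_mem_Icc hab hy p
  have hintv : ∀ x ∈ Set.Icc a b, IntervalIntegrable (fun ξ => 1 / σ ξ) volume a x := fun x hx =>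
    (intervalIntegrable_iff_integrableOn_Icc_of_le hx.1).2
      (hσ.mono_set (Set.Icc_subset_Icc_right hx.2))
  refine (continuousOn_finsetSum (Finset.range (n + 1)) fun p _ =>
    ((hnode (p + 1)).sub (hnode p)).const_mul ((-1 : ℝ) ^ p)).congr fun y hy => ?_
  refine Finset.sum_congr rfl fun p _ => ?_
  rw [Pi.sub_apply, intervalIntegral.integral_interval_sub_left
    (hintv _ (nodes_mem_Icc hab hy (p + 1))) (hintv _ (nodes_mem_Icc hab hy p))]

lemma abs_phase_le {σ : ℝ → ℝ} {a b : ℝ} (hab : a ≤ b)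
    (hσ : IntegrableOn (fun ξ => 1 / σ ξ) (Set.Icc a b)) (hσpos : ∀ x ∈ Set.Icc a b, 0 < σ x)
    {n : ℕ} {y : Fin n → ℝ} (hy : y ∈ simplex a b n) :
    |phase σ a b n y| ≤ ∫ ξ in a..b, 1 / σ ξ := by
  have hsub : ∀ p, Set.Icc (nodes a b n y p) (nodes a b n y (p + 1)) ⊆ Set.Icc a b := fun p =>
    Set.Icc_subset_Icc (nodes_mem_Icc hab hy p).1 (nodes_mem_Icc hab hy (p + 1)).2
  have hsum := intervalIntegral.sum_integral_adjacent_intervals (μ := volume)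
    (f := fun ξ => 1 / σ ξ) (a := nodes a b n y) (n := n + 1) fun p hp =>
      (intervalIntegrable_iff_integrableOn_Icc_of_le
        (nodes_le_succ hab hy (Nat.lt_succ_iff.1 hp))).2 (hσ.mono_set (hsub p))
  rw [nodes_zero, nodes_last] at hsum
  rw [← hsum]
  refine (Finset.abs_sum_le_sum_abs _ _).trans_eq (Finset.sum_congr rfl fun p hp => ?_)
  rw [abs_mul, abs_pow, abs_neg, abs_one, one_pow, one_mul, abs_of_nonneg]
  exact intervalIntegral.integral_nonneg
    (nodes_le_succ hab hy (Nat.lt_succ_iff.1 (Finset.mem_range.1 hp)))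
    fun x hx => (one_div_pos.2 (hσpos x (hsub p hx))).le

lemma norm_sin_mul_phase_le {σ : ℝ → ℝ} {a b : ℝ} (hab : a ≤ b)
    (hσ : IntegrableOn (fun ξ => 1 / σ ξ) (Set.Icc a b)) (hσpos : ∀ x ∈ Set.Icc a b, 0 < σ x)
    (k : ℂ) {n : ℕ} {y : Fin n → ℝ} (hy : y ∈ simplex a b n) :
    ‖Complex.sin (k * (phase σ a b n y : ℂ))‖ ≤
      Real.exp (|k.im| * ∫ ξ in a..b, 1 / σ ξ) := by
  refine (Complex.norm_sin_le_exp_abs_im _).trans (Real.exp_le_exp.2 ?_)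
  rw [Complex.im_mul_ofReal, abs_mul]
  exact mul_le_mul_of_nonneg_left (abs_phase_le hab hσ hσpos hy) (abs_nonneg _)

lemma sigmaAC.continuousOn {σ : ℝ → ℝ} (hσ : sigmaAC σ) : ContinuousOn σ (Set.Icc 0 1) := by
  have hprim : ContinuousOn (fun x => ∫ t in (0 : ℝ)..x, deriv σ t) (Set.Icc 0 1) := by
    have hint := hσ.1
    rw [← Set.uIcc_of_le zero_le_one] at hint ⊢
    exact intervalIntegral.continuousOn_primitive_interval hint
  exact (continuousOn_const.add hprim).congr hσ.2

lemma integrableOn_Sintegrand {σ : ℝ → ℝ} {a b : ℝ} (hab : a ≤ b)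
    (hσ : IntegrableOn (fun ξ => 1 / σ ξ) (Set.Icc a b)) (hσpos : ∀ x ∈ Set.Icc a b, 0 < σ x)
    (hratio : IntegrableOn (fun t => deriv σ t / σ t) (Set.Icc a b)) (k : ℂ) (n : ℕ) :
    IntegrableOn (Sintegrand σ a b n k) (simplex a b n) := by
  have hmeas := (isClosed_simplex a b n).measurableSet
  have hcont : ContinuousOn (fun y => Complex.sin (k * (phase σ a b n y : ℂ)))
      (simplex a b n) :=
    Complex.continuous_sin.comp_continuousOn (continuousOn_const.mul
      (Complex.continuous_ofReal.comp_continuousOn (continuousOn_phase hab hσ n)))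
  have hprod := ((integrableOn_prod_simplex hratio n).mono_set
    (simplex_subset_pi_Icc a b n)).ofReal (𝕜 := ℂ)
  refine (Integrable.bdd_mul hprod (hcont.aestronglyMeasurable hmeas)
    ((ae_restrict_iff' hmeas).2 (Eventually.of_forall fun y hy =>
      norm_sin_mul_phase_le hab hσ hσpos k hy))).congr (Eventually.of_forall fun y => ?_)
  exact mul_comm _ _

lemma norm_S_le {σ : ℝ → ℝ} {a b : ℝ} (hab : a ≤ b)
    (hσ : IntegrableOn (fun ξ => 1 / σ ξ) (Set.Icc a b)) (hσpos : ∀ x ∈ Set.Icc a b, 0 < σ x)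
    (hratio : IntegrableOn (fun t => deriv σ t / σ t) (Set.Icc a b)) (k : ℂ) (n : ℕ) :
    ‖S σ a b n k‖ ≤ 1 / (2 ^ n * n.factorial) * (∫ ξ in a..b, |deriv σ ξ| / σ ξ) ^ n *
      Real.exp (|k.im| * ∫ ξ in a..b, 1 / σ ξ) := by
  set E := Real.exp (|k.im| * ∫ ξ in a..b, 1 / σ ξ)
  have hmeas := (isClosed_simplex a b n).measurableSet
  have habs : IntegrableOn (fun t => |deriv σ t / σ t|) (Set.Icc a b) := hratio.abs
  have hnorm : ‖∫ y in simplex a b n, Sintegrand σ a b n k y‖ ≤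
      ∫ y in simplex a b n, (∏ p, |deriv σ (y p) / σ (y p)|) * E := by
    refine norm_integral_le_of_norm_le (((integrableOn_prod_simplex habs n).mono_set
      (simplex_subset_pi_Icc a b n)).mul_const E)
      ((ae_restrict_iff' hmeas).2 (Eventually.of_forall fun y hy => ?_))
    rw [Sintegrand, norm_mul, Complex.norm_real, Real.norm_eq_abs, Finset.abs_prod]
    exact mul_le_mul_of_nonneg_left (norm_sin_mul_phase_le hab hσ hσpos k hy)
      (Finset.prod_nonneg fun _ _ => abs_nonneg _)
  rw [integral_mul_const] at hnorm
  have hfact := factorial_mul_setIntegral_simplex_prod_le (fun _ => abs_nonneg _) habs n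
  have hratio_eq : ∫ x in Set.Icc a b, |deriv σ x / σ x| = ∫ ξ in a..b, |deriv σ ξ| / σ ξ := by
    rw [intervalIntegral.integral_of_le hab, ← integral_Icc_eq_integral_Ioc]
    refine setIntegral_congr_fun measurableSet_Icc fun x hx => ?_
    simp only [abs_div, abs_of_pos (hσpos x hx)]
  rw [hratio_eq, mul_comm, ← le_div_iff₀ (by positivity)] at hfact
  rw [S, norm_mul, norm_inv, norm_pow, Complex.norm_two]
  calc ((2 : ℝ) ^ n)⁻¹ * ‖∫ y in simplex a b n, Sintegrand σ a b n k y‖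
      ≤ ((2 : ℝ) ^ n)⁻¹ * ((∫ ξ in a..b, |deriv σ ξ| / σ ξ) ^ n / n.factorial * E) := by
        gcongr
        exact hnorm.trans (mul_le_mul_of_nonneg_right hfact (Real.exp_nonneg _))
    _ = _ := by
        field_simp

/-- Bound and absolute convergence for `S_n^{(a,b)}(k)`. -/
theorem stmt_3 (σ : ℝ → ℝ)
    (hσpos : ∀ x ∈ Set.Icc (0 : ℝ) 1, 0 < σ x)
    (hσAC : sigmaAC σ)
    (hratio : IntegrableOn (fun t => deriv σ t / σ t) (Set.Ioo 0 1))
    (a b : ℝ) (ha : 0 ≤ a) (hab : a ≤ b) (hb : b ≤ 1) (k : ℂ) :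
    (∀ n : ℕ, IntegrableOn (Sintegrand σ a b n k) (simplex a b n)) ∧
    (∀ n : ℕ, ‖S σ a b n k‖ ≤
      1 / (2 ^ n * n.factorial) * (∫ ξ in a..b, |deriv σ ξ| / σ ξ) ^ n *
        Real.exp (|k.im| * ∫ ξ in a..b, 1 / σ ξ)) ∧
    Summable (fun n => ‖S σ a b n k‖) ∧
    (∑' n, ‖S σ a b n k‖) ≤
      Real.exp ((1 / 2) * ∫ ξ in a..b, |deriv σ ξ| / σ ξ) *
        Real.exp (|k.im| * ∫ ξ in a..b, 1 / σ ξ) := by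
  have hsub : Set.Icc a b ⊆ Set.Icc 0 1 := Set.Icc_subset_Icc ha hb
  have hpos : ∀ x ∈ Set.Icc a b, 0 < σ x := fun x hx => hσpos x (hsub hx)
  have hinv : IntegrableOn (fun ξ => 1 / σ ξ) (Set.Icc a b) :=
    ((continuousOn_const.div hσAC.continuousOn fun x hx =>
      (hσpos x hx).ne').mono hsub).integrableOn_Icc
  have hr : IntegrableOn (fun t => deriv σ t / σ t) (Set.Icc a b) :=
    ((integrableOn_Icc_iff_integrableOn_Ioo (by finiteness) (by finiteness)).2 hratio).mono_set
      hsub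
  have hbound := norm_S_le hab hinv hpos hr k
  set R := ∫ ξ in a..b, |deriv σ ξ| / σ ξ
  set E := Real.exp (|k.im| * ∫ ξ in a..b, 1 / σ ξ)
  have hmaj : HasSum (fun n : ℕ => 1 / (2 ^ n * n.factorial) * R ^ n * E)
      (Real.exp (1 / 2 * R) * E) := by
    have h := (NormedSpace.expSeries_div_hasSum_exp (1 / 2 * R)).mul_right E
    rw [← Real.exp_eq_exp_ℝ] at h
    refine h.congr_fun fun n => ?_
    rw [mul_pow, one_div_pow]
    field_simp
  have hsum := Summable.of_nonneg_of_le (fun n => norm_nonneg (S σ a b n k)) hbound hmaj.summable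
  exact ⟨integrableOn_Sintegrand hab hinv hpos hr k, hbound, hsum,
    (hsum.tsum_le_tsum hbound hmaj.summable).trans_eq hmaj.tsum_eq⟩
end
end

section
/- Reality of the zeros of Δ. Every zero of Δ is real: if k ∈ ℂ satisfies Δ(k) = 0, then k ∈ ℝ. -/
open MeasureTheory Filter

noncomputable section

/-- `f` is the primitive of the integrable function `φ` on `[0,1]`. -/
def HasDensity (f φ : ℝ → ℂ) : Prop :=
  IntegrableOn φ (Set.Ioc 0 1) ∧
    ∀ x ∈ Set.Icc (0 : ℝ) 1, f x = f 0 + ∫ t in Set.Ioc 0 x, φ t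

/-- Fubini on the square `(0,x]²`, cut along its diagonal. -/
lemma integral_mul_integral_Ioc {φ ψ : ℝ → ℂ} {x : ℝ}
    (hφ : IntegrableOn φ (Set.Ioc 0 x)) (hψ : IntegrableOn ψ (Set.Ioc 0 x)) :
    (∫ s in Set.Ioc 0 x, φ s) * (∫ t in Set.Ioc 0 x, ψ t) =
      (∫ t in Set.Ioc 0 x, (∫ s in Set.Ioc 0 t, φ s) * ψ t) +
        ∫ s in Set.Ioc 0 x, φ s * ∫ t in Set.Ioc 0 s, ψ t := by
  set μ := volume.restrict (Set.Ioc (0 : ℝ) x) with hμ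
  have hJ : Integrable (fun z : ℝ × ℝ => φ z.1 * ψ z.2) (μ.prod μ) := Integrable.mul_prod hφ hψ
  have hA : MeasurableSet {z : ℝ × ℝ | z.1 ≤ z.2} := measurableSet_le measurable_fst measurable_snd
  have hsplit := integral_add_compl hA hJ
  rw [integral_prod_mul φ ψ] at hsplit
  rw [← hsplit, ← integral_indicator hA, ← integral_indicator hA.compl,
    integral_prod_symm _ (hJ.indicator hA), integral_prod _ (hJ.indicator hA.compl)]
  have hres : ∀ t ∈ Set.Ioc 0 x, ∀ g : ℝ → ℂ,
      ∫ s in Set.Ioc 0 t, g s = ∫ s, (Set.Iic t).indicator g s ∂μ := by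
    intro t ht g
    rw [integral_indicator measurableSet_Iic, hμ, Measure.restrict_restrict measurableSet_Iic,
      Set.Iic_inter_Ioc_of_le ht.2]
  congr 1
  · refine setIntegral_congr_fun measurableSet_Ioc fun t ht => ?_
    rw [hres t ht φ, ← integral_mul_const]
    congr 1 with s
    by_cases h : s ≤ t <;> simp [Set.indicator, h]
  · refine setIntegral_congr_fun measurableSet_Ioc fun t ht => ?_
    rw [hres t ht ψ, ← integral_const_mul]
    have hne : ∀ᵐ s ∂μ, s ≠ t := by
      have := (measure_singleton (μ := μ) t)
      exact (measure_eq_zero_iff_ae_notMem.mp this).mono fun s hs => by simpa using hs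
    refine integral_congr_ae (hne.mono fun s hs => ?_)
    rcases lt_or_gt_of_ne hs with h | h
    · simp [Set.indicator, h, h.le]
    · simp [Set.indicator, h.le, h]

namespace HasDensity
variable {f g φ ψ : ℝ → ℂ}

lemma integrableOn (h : HasDensity f φ) {x : ℝ} (hx : x ≤ 1) : IntegrableOn φ (Set.Ioc 0 x) :=
  h.1.mono_set (Set.Ioc_subset_Ioc_right hx)

lemma continuousOn (h : HasDensity f φ) : ContinuousOn f (Set.Icc 0 1) := by
  have hp : ContinuousOn (fun x => ∫ t in Set.Ioc 0 x, φ t) (Set.Icc 0 1) :=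
    intervalIntegral.continuousOn_primitive ((integrableOn_Icc_iff_integrableOn_Ioc).2 h.1)
  exact (continuousOn_const.add hp).congr h.2

lemma integrableOn_mul (h : HasDensity f φ) (hψ : IntegrableOn ψ (Set.Ioc 0 1)) :
    IntegrableOn (fun t => f t * ψ t) (Set.Ioc 0 1) := by
  rw [← integrableOn_Icc_iff_integrableOn_Ioc] at hψ ⊢
  exact hψ.continuousOn_mul h.continuousOn isCompact_Icc

lemma congr (h : HasDensity f φ) (hf : ∀ x ∈ Set.Icc (0 : ℝ) 1, f x = g x)
    (hφ : ∀ x ∈ Set.Icc (0 : ℝ) 1, φ x = ψ x) : HasDensity g ψ := by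
  refine ⟨h.1.congr_fun (fun x hx => hφ x ⟨hx.1.le, hx.2⟩) measurableSet_Ioc, fun x hx => ?_⟩
  rw [← hf x hx, ← hf 0 (by simp), h.2 x hx]
  congr 1
  exact setIntegral_congr_fun measurableSet_Ioc fun t ht => hφ t ⟨ht.1.le, ht.2.trans hx.2⟩

lemma add (hf : HasDensity f φ) (hg : HasDensity g ψ) :
    HasDensity (fun x => f x + g x) (fun x => φ x + ψ x) := by
  refine ⟨hf.1.add hg.1, fun x hx => ?_⟩
  beta_reduce
  rw [integral_add (hf.integrableOn hx.2) (hg.integrableOn hx.2), hf.2 x hx, hg.2 x hx]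
  ring

lemma const_mul (c : ℂ) (hf : HasDensity f φ) :
    HasDensity (fun x => c * f x) (fun x => c * φ x) := by
  refine ⟨Integrable.const_mul hf.1 c, fun x hx => ?_⟩
  beta_reduce
  rw [integral_const_mul, hf.2 x hx]
  ring

lemma conj (hf : HasDensity f φ) :
    HasDensity (fun x => (starRingEnd ℂ) (f x)) (fun x => (starRingEnd ℂ) (φ x)) := by
  refine ⟨Complex.conjCLE.toContinuousLinearMap.integrable_comp hf.1, fun x hx => ?_⟩
  beta_reduce
  rw [integral_conj, hf.2 x hx, map_add]

lemma mul (hf : HasDensity f φ) (hg : HasDensity g ψ) :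
    HasDensity (fun x => f x * g x) (fun x => φ x * g x + f x * ψ x) := by
  have h1 : IntegrableOn (fun x => φ x * g x) (Set.Ioc 0 1) := by
    simpa only [mul_comm] using hg.integrableOn_mul hf.1
  have h2 := hf.integrableOn_mul hg.1
  refine ⟨h1.add h2, fun x hx => ?_⟩
  have hs : Set.Ioc 0 x ⊆ Set.Ioc (0 : ℝ) 1 := Set.Ioc_subset_Ioc_right hx.2
  have hφ := hf.integrableOn hx.2
  have hψ := hg.integrableOn hx.2
  have e1 : ∫ t in Set.Ioc 0 x, φ t * g t = (∫ t in Set.Ioc 0 x, φ t) * g 0 +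
      ∫ s in Set.Ioc 0 x, φ s * ∫ t in Set.Ioc 0 s, ψ t := by
    have : ∀ t ∈ Set.Ioc 0 x, φ t * ∫ u in Set.Ioc 0 t, ψ u = φ t * g t - φ t * g 0 :=
      fun t ht => by rw [hg.2 t ⟨ht.1.le, ht.2.trans hx.2⟩]; ring
    rw [setIntegral_congr_fun measurableSet_Ioc this,
      integral_sub (h1.mono_set hs) (hφ.mul_const _), integral_mul_const]
    ring
  have e2 : ∫ t in Set.Ioc 0 x, f t * ψ t = f 0 * (∫ t in Set.Ioc 0 x, ψ t) +
      ∫ t in Set.Ioc 0 x, (∫ s in Set.Ioc 0 t, φ s) * ψ t := by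
    have : ∀ t ∈ Set.Ioc 0 x, (∫ u in Set.Ioc 0 t, φ u) * ψ t = f t * ψ t - f 0 * ψ t :=
      fun t ht => by rw [hf.2 t ⟨ht.1.le, ht.2.trans hx.2⟩]; ring
    rw [setIntegral_congr_fun measurableSet_Ioc this,
      integral_sub (h2.mono_set hs) (hψ.const_mul _), integral_const_mul]
    ring
  beta_reduce
  rw [integral_add (h1.mono_set hs) (h2.mono_set hs), e1, e2, hf.2 x hx, hg.2 x hx]
  linear_combination integral_mul_integral_Ioc hφ hψ

lemma tsum {f φ : ℕ → ℝ → ℂ} (h : ∀ n, HasDensity (f n) (φ n)) {a : ℕ → ℝ} (ha : Summable a)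
    (hf : ∀ n, ∀ x ∈ Set.Icc (0 : ℝ) 1, ‖f n x‖ ≤ a n) {G : ℝ → ℝ}
    (hG : IntegrableOn G (Set.Ioc 0 1))
    (hφ : ∀ n, ∀ x ∈ Set.Icc (0 : ℝ) 1, ‖φ n x‖ ≤ a n * G x) :
    HasDensity (fun x => ∑' n, f n x) (fun x => ∑' n, φ n x) := by
  have hsum : ∀ x ∈ Set.Icc (0 : ℝ) 1, HasSum (fun n => φ n x) (∑' n, φ n x) := fun x hx =>
    (Summable.of_norm_bounded (ha.mul_right (G x)) fun n => hφ n x hx).hasSum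
  have hfs : ∀ x ∈ Set.Icc (0 : ℝ) 1, Summable (fun n => f n x) := fun x hx =>
    Summable.of_norm_bounded ha fun n => hf n x hx
  have hs : ∀ {x : ℝ}, x ≤ 1 → ∀ t ∈ Set.Ioc 0 x, t ∈ Set.Icc (0 : ℝ) 1 :=
    fun hx t ht => ⟨ht.1.le, ht.2.trans hx⟩
  have hae : ∀ᵐ t ∂(volume.restrict (Set.Ioc (0 : ℝ) 1)), t ∈ Set.Icc (0 : ℝ) 1 :=
    (ae_restrict_mem measurableSet_Ioc).mono (hs le_rfl)
  constructor
  · refine Integrable.mono' (hG.const_mul (∑' n, a n)) ?_ (hae.mono fun t ht => ?_)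
    · refine aestronglyMeasurable_of_tendsto_ae atTop
        (f := fun n t => ∑ i ∈ Finset.range n, φ i t) (fun n => ?_)
        (hae.mono fun t ht => (hsum t ht).tendsto_sum_nat)
      exact Finset.aestronglyMeasurable_fun_sum _ fun i _ => (h i).1.aestronglyMeasurable
    · rw [← tsum_mul_right]
      exact tsum_of_norm_bounded (ha.mul_right (G t)).hasSum fun n => hφ n t ht
  · intro x hx
    have hae' : ∀ᵐ t ∂(volume.restrict (Set.Ioc (0 : ℝ) x)), t ∈ Set.Icc (0 : ℝ) 1 :=
      (ae_restrict_mem measurableSet_Ioc).mono (hs hx.2)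
    have key := hasSum_integral_of_dominated_convergence
      (μ := volume.restrict (Set.Ioc (0 : ℝ) x)) (F := φ) (f := fun t => ∑' n, φ n t)
      (fun n t => a n * G t) (fun n => ((h n).integrableOn hx.2).aestronglyMeasurable)
      (fun n => hae'.mono fun t ht => hφ n t ht)
      (Eventually.of_forall fun t => ha.mul_right (G t))
      (by
        simp only [_root_.tsum_mul_right]
        exact (hG.mono_set (Set.Ioc_subset_Ioc_right hx.2)).const_mul _)
      (hae'.mono fun t ht => hsum t ht)
    have h0 := (hfs 0 (by simp)).hasSum.add key
    rw [← h0.tsum_eq]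
    exact tsum_congr fun n => (h n).2 x hx

end HasDensity

/-- `∫_{0 < y₁ < ⋯ < y_n < x} ∏ r_p(y_{p+1})`, as an iterated integral. -/
def iteratedPrimitive (r : ℕ → ℝ → ℂ) : ℕ → ℝ → ℂ
  | 0 => fun _ => 1
  | n + 1 => fun x => ∫ t in Set.Ioc 0 x, r n t * iteratedPrimitive r n t

lemma HasDensity.const (c : ℂ) : HasDensity (fun _ => c) (fun _ => 0) :=
  ⟨integrableOn_zero, fun x _ => by simp⟩

lemma HasDensity.of_primitive {φ : ℝ → ℂ} (hφ : IntegrableOn φ (Set.Ioc 0 1)) :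
    HasDensity (fun x => ∫ t in Set.Ioc 0 x, φ t) φ :=
  ⟨hφ, fun x _ => by simp⟩

lemma HasDensity.pow {f φ : ℝ → ℂ} (h : HasDensity f φ) (n : ℕ) :
    HasDensity (fun x => f x ^ (n + 1)) (fun x => (n + 1) * (φ x * f x ^ n)) := by
  induction n with
  | zero => simpa using h
  | succ n ih =>
    refine (ih.mul h).congr (fun x _ => by ring) (fun x _ => ?_)
    push_cast
    ring

section IteratedPrimitive
variable {r : ℕ → ℝ → ℂ} (hr : ∀ n, IntegrableOn (r n) (Set.Ioc 0 1))
include hr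

lemma iteratedPrimitive_continuousOn (n : ℕ) :
    ContinuousOn (iteratedPrimitive r n) (Set.Icc 0 1) ∧
      IntegrableOn (fun t => r n t * iteratedPrimitive r n t) (Set.Ioc 0 1) := by
  have aux : ∀ n, ContinuousOn (iteratedPrimitive r n) (Set.Icc 0 1) →
      IntegrableOn (fun t => r n t * iteratedPrimitive r n t) (Set.Ioc 0 1) := by
    intro n h
    have := hr n
    rw [← integrableOn_Icc_iff_integrableOn_Ioc] at this ⊢
    exact this.mul_continuousOn h isCompact_Icc
  induction n with
  | zero => exact ⟨continuousOn_const, aux 0 continuousOn_const⟩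
  | succ n ih =>
    have := (HasDensity.of_primitive ih.2).continuousOn
    exact ⟨this, aux _ this⟩

lemma hasDensity_iteratedPrimitive (n : ℕ) :
    HasDensity (iteratedPrimitive r (n + 1)) (fun t => r n t * iteratedPrimitive r n t) :=
  .of_primitive (iteratedPrimitive_continuousOn hr n).2

end IteratedPrimitive

lemma norm_iteratedPrimitive_le {r : ℕ → ℝ → ℂ} {G : ℝ → ℝ} (hG : IntegrableOn G (Set.Ioc 0 1))
    (hG0 : ∀ x, 0 ≤ G x)
    (hrG : ∀ n, ∀ x ∈ Set.Icc (0 : ℝ) 1, ‖r n x‖ ≤ G x) (n : ℕ) :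
    ∀ x ∈ Set.Icc (0 : ℝ) 1,
      ‖iteratedPrimitive r n x‖ ≤ (∫ t in Set.Ioc 0 x, G t) ^ n / n.factorial := by
  induction n with
  | zero => simp [iteratedPrimitive]
  | succ n ih =>
    intro x hx
    set L : ℝ → ℝ := fun x => ∫ t in Set.Ioc 0 x, G t with hL
    have hd := (HasDensity.of_primitive (φ := fun t => (G t : ℂ)) hG.ofReal).pow n
    have hcast : ∀ x, ∫ t in Set.Ioc 0 x, (G t : ℂ) = (L x : ℂ) := fun x => integral_ofReal
    simp only [hcast] at hd
    have hreal := hd.2 x hx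
    have hL0 : L 0 = 0 := by simp [hL]
    beta_reduce at hreal
    rw [hL0] at hreal
    have hcast2 : ∀ t, ((n : ℂ) + 1) * ((G t : ℂ) * (L t : ℂ) ^ n) =
        (((n + 1) * (G t * L t ^ n) : ℝ) : ℂ) := fun t => by push_cast; ring
    simp only [hcast2] at hreal
    rw [integral_complex_ofReal] at hreal
    have hpow : L x ^ (n + 1) = (n + 1) * ∫ t in Set.Ioc 0 x, G t * L t ^ n := by
      rw [← integral_const_mul]
      have : ((L x ^ (n + 1) : ℝ) : ℂ) =
        ((∫ t in Set.Ioc 0 x, (n + 1) * (G t * L t ^ n) : ℝ) : ℂ) := by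
        push_cast at hreal ⊢
        simpa using hreal
      exact_mod_cast this
    have hint : IntegrableOn (fun t => G t * L t ^ n) (Set.Ioc 0 x) := by
      have h := hd.integrableOn hx.2
      simp only [hcast2] at h
      have h' := (Integrable.re h).const_mul ((n + 1 : ℝ)⁻¹)
      refine h'.congr (Eventually.of_forall fun t => ?_)
      simp only [RCLike.re_to_complex, Complex.ofReal_re]
      field_simp
    calc ‖iteratedPrimitive r (n + 1) x‖
        ≤ ∫ t in Set.Ioc 0 x, (n.factorial : ℝ)⁻¹ * (G t * L t ^ n) := by
          refine norm_integral_le_of_norm_le (hint.const_mul _) ?_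
          refine (ae_restrict_mem measurableSet_Ioc).mono fun t ht => ?_
          have ht' : t ∈ Set.Icc (0 : ℝ) 1 := ⟨ht.1.le, ht.2.trans hx.2⟩
          rw [norm_mul]
          calc _ ≤ G t * (L t ^ n / n.factorial) :=
                mul_le_mul (hrG n t ht') (ih t ht') (norm_nonneg _) (hG0 t)
            _ = _ := by ring
      _ = L x ^ (n + 1) / (n + 1).factorial := by
          rw [integral_const_mul, hpow, Nat.factorial_succ]
          push_cast
          field_simp

section Simplex

lemma measurableSet_simplex (a b : ℝ) (n : ℕ) : MeasurableSet (simplex a b n) := by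
  have h1 : MeasurableSet {y : Fin n → ℝ | Monotone y} := isClosed_monotone.measurableSet
  have h2 : MeasurableSet {y : Fin n → ℝ | ∀ i, y i ∈ Set.Icc a b} := by
    have : {y : Fin n → ℝ | ∀ i, y i ∈ Set.Icc a b} =
        Set.univ.pi fun _ => Set.Icc a b := by ext; simp only [Set.mem_ofPred_eq, Set.mem_univ_pi]
    rw [this]
    exact MeasurableSet.univ_pi fun _ => measurableSet_Icc
  exact h1.inter h2

lemma mem_simplex_succ {x : ℝ} {n : ℕ} (y : Fin (n + 1) → ℝ) :
    y ∈ simplex 0 x (n + 1) ↔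
      y (Fin.last n) ∈ Set.Icc 0 x ∧ (fun i : Fin n => y i.castSucc) ∈ simplex 0 (y (Fin.last n)) n := by
  constructor
  · rintro ⟨hm, hy⟩
    exact ⟨hy _, fun i j hij => hm (Fin.castSucc_le_castSucc_iff.2 hij),
      fun i => ⟨(hy _).1, hm (Fin.le_last _)⟩⟩
  · rintro ⟨hl, hm, hy⟩
    refine ⟨fun i j hij => ?_, fun i => ?_⟩
    · induction j using Fin.lastCases with
      | last =>
        induction i using Fin.lastCases with
        | last => exact le_rfl
        | cast i => exact (hy i).2
      | cast j =>
        induction i using Fin.lastCases with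
        | last => exact absurd hij (not_le.2 (Fin.castSucc_lt_last j))
        | cast i => exact hm (Fin.castSucc_le_castSucc_iff.1 hij)
    · induction i using Fin.lastCases with
      | last => exact hl
      | cast i => exact ⟨(hy i).1, (hy i).2.trans hl.2⟩

variable {r : ℕ → ℝ → ℂ} (hr : ∀ n, IntegrableOn (r n) (Set.Ioc 0 1))
include hr

lemma integrableOn_simplex_prod (n : ℕ) {x : ℝ} (hx : x ≤ 1) :
    IntegrableOn (fun y : Fin n → ℝ => ∏ i : Fin n, r i (y i)) (simplex 0 x n) := by
  have h : IntegrableOn (fun y : Fin n → ℝ => ∏ i : Fin n, r i (y i))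
      (Set.univ.pi fun _ => Set.Icc 0 1) := by
    rw [IntegrableOn, volume_pi, Measure.restrict_pi_pi]
    exact Integrable.fintype_prod (f := fun (i : Fin n) t => r i t)
      fun i => (integrableOn_Icc_iff_integrableOn_Ioc).2 (hr i)
  exact h.mono_set fun y hy i _ => ⟨(hy.2 i).1, (hy.2 i).2.trans hx⟩

lemma setIntegral_simplex_prod (n : ℕ) {x : ℝ} (hx : x ≤ 1) :
    ∫ y in simplex 0 x n, ∏ i : Fin n, r i (y i) = iteratedPrimitive r n x := by
  induction n generalizing x with
  | zero =>
    have : simplex 0 x 0 = Set.univ :=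
      Set.eq_univ_of_forall fun y => ⟨fun i => i.elim0, fun i => i.elim0⟩
    rw [this, Measure.restrict_univ, volume_pi, Measure.pi_of_empty _ isEmptyElim]
    simp [iteratedPrimitive]
  | succ n ih =>
    set e := MeasurableEquiv.piFinSuccAbove (fun _ : Fin (n + 1) => ℝ) (Fin.last n)
    have he : MeasurePreserving e := volume_preserving_piFinSuccAbove _ _
    set g : ℝ × (Fin n → ℝ) → ℂ := fun z => (Set.Icc 0 x).indicator (fun t => r n t *
      (simplex 0 t n).indicator (fun y => ∏ i : Fin n, r i (y i)) z.2) z.1 with hg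
    have hge : ∀ y, (simplex 0 x (n + 1)).indicator
        (fun y => ∏ i : Fin (n + 1), r i (y i)) y = g (e y) := by
      intro y
      have e1 : (e y).1 = y (Fin.last n) := rfl
      have e2 : (e y).2 = fun i : Fin n => y i.castSucc := by
        funext i
        change y ((Fin.last n).succAbove i) = _
        rw [Fin.succAbove_last]
      simp only [hg, e1, e2]
      by_cases h1 : y (Fin.last n) ∈ Set.Icc 0 x
      · rw [Set.indicator_of_mem h1]
        by_cases h2 : (fun i : Fin n => y i.castSucc) ∈ simplex 0 (y (Fin.last n)) n
        · rw [Set.indicator_of_mem h2, Set.indicator_of_mem ((mem_simplex_succ y).2 ⟨h1, h2⟩),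
            Fin.prod_univ_castSucc, mul_comm]
          rfl
        · rw [Set.indicator_of_notMem h2,
            Set.indicator_of_notMem fun h => h2 ((mem_simplex_succ y).1 h).2, mul_zero]
      · rw [Set.indicator_of_notMem h1,
          Set.indicator_of_notMem fun h => h1 ((mem_simplex_succ y).1 h).1]
    have hgint : Integrable g (volume.prod volume) := by
      have h := (integrableOn_simplex_prod hr (n + 1) hx).integrable_indicator
        (measurableSet_simplex _ _ _)
      rw [show (simplex 0 x (n + 1)).indicator
        (fun y => ∏ i : Fin (n + 1), r i (y i)) = g ∘ e from funext hge] at h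
      exact (he.integrable_comp_emb e.measurableEmbedding).1 h
    rw [← integral_indicator (measurableSet_simplex _ _ _), integral_congr_ae
      (Eventually.of_forall hge), he.integral_comp', Measure.volume_eq_prod,
      integral_prod _ hgint]
    have : ∀ t, ∫ y, g (t, y) =
        (Set.Icc 0 x).indicator (fun t => r n t * iteratedPrimitive r n t) t := by
      intro t
      by_cases ht : t ∈ Set.Icc 0 x
      · simp only [hg, Set.indicator_of_mem ht]
        rw [integral_const_mul, integral_indicator (measurableSet_simplex _ _ _),
          ih (ht.2.trans hx)]
      · simp [hg, Set.indicator_of_notMem ht]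
    simp only [this]
    rw [integral_indicator measurableSet_Icc, integral_Icc_eq_integral_Ioc]
    rfl

end Simplex

section Series

/-- The phase-free kernel `(q/2) e^{2ik(-1)ⁿw}`. -/
def phaseKernel (q w : ℝ → ℝ) (k : ℂ) (n : ℕ) (t : ℝ) : ℂ :=
  Complex.exp (2 * Complex.I * k * (-1) ^ n * w t) * (q t / 2)

/-- The `n`-th term of the exponential analogue of the series `∑ S_n^{(0,x)}(k)`. -/
def expTerm (q w : ℝ → ℝ) (k : ℂ) (n : ℕ) (x : ℝ) : ℂ :=
  Complex.exp (Complex.I * k * (-1) ^ n * w x) * iteratedPrimitive (phaseKernel q w k) n x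

/-- The sine terms `S_n^{(0,x)}(k)`. -/
def sinTerm (q w : ℝ → ℝ) (k : ℂ) (n : ℕ) (x : ℝ) : ℂ :=
  (expTerm q w k n x - expTerm q w (-k) n x) / (2 * Complex.I)

/-- The alternating cosine terms `(-1)ⁿ C_n^{(0,x)}(k)`. -/
def cosTerm (q w : ℝ → ℝ) (k : ℂ) (n : ℕ) (x : ℝ) : ℂ :=
  (-1) ^ n * (expTerm q w k n x + expTerm q w (-k) n x) / 2

/-- The sequence `u` shifted by one place to the right. -/
def shiftRight (u : ℕ → ℂ) : ℕ → ℂ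
  | 0 => 0
  | n + 1 => u n

lemma tsum_shiftRight {u : ℕ → ℂ} (hu : Summable u) : ∑' n, shiftRight u n = ∑' n, u n := by
  have : Summable (shiftRight u) := (summable_nat_add_iff 1).1 hu
  rw [this.tsum_eq_zero_add]
  simp [shiftRight]

lemma summable_shiftRight {u : ℕ → ℂ} (hu : Summable u) : Summable (shiftRight u) :=
  (summable_nat_add_iff 1).1 hu

variable {ρ q w : ℝ → ℝ} (hρ : ContinuousOn ρ (Set.Icc 0 1)) (hq : IntegrableOn q (Set.Ioc 0 1))
  (hw : ∀ x ∈ Set.Icc (0 : ℝ) 1, w x = ∫ t in (0 : ℝ)..x, ρ t)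

include hρ hw in
lemma continuousOn_of_eq_integral : ContinuousOn w (Set.Icc 0 1) := by
  have h : ContinuousOn (fun x => ∫ t in (0 : ℝ)..x, ρ t) (Set.Icc 0 1) := by
    have := intervalIntegral.continuousOn_primitive_interval (μ := volume) (f := ρ) (a := 0) (b := 1)
      (by simpa using hρ.integrableOn_Icc)
    simpa using this
  exact h.congr hw

include hρ hw in
lemma hasDensity_exp (c : ℂ) :
    HasDensity (fun x => Complex.exp (c * w x))
      (fun x => c * ρ x * Complex.exp (c * w x)) := by
  have hwc := continuousOn_of_eq_integral hρ hw
  have hec : ContinuousOn (fun x => Complex.exp (c * w x)) (Set.Icc 0 1) :=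
    (continuousOn_const.mul (Complex.continuous_ofReal.comp_continuousOn hwc)).cexp
  have hdc : ContinuousOn (fun x => c * ρ x * Complex.exp (c * w x)) (Set.Icc 0 1) :=
    (continuousOn_const.mul (Complex.continuous_ofReal.comp_continuousOn hρ)).mul hec
  refine ⟨hdc.integrableOn_Icc.mono_set Set.Ioc_subset_Icc_self, fun x hx => ?_⟩
  have hsub : Set.Icc 0 x ⊆ Set.Icc (0 : ℝ) 1 := Set.Icc_subset_Icc_right hx.2
  have hint : IntervalIntegrable (fun x => c * ρ x * Complex.exp (c * w x)) volume 0 x :=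
    ContinuousOn.intervalIntegrable_of_Icc hx.1 (hdc.mono hsub)
  have key := intervalIntegral.integral_eq_sub_of_hasDerivAt_of_le hx.1 (hec.mono hsub)
    (fun y hy => ?_) hint
  · rw [intervalIntegral.integral_of_le hx.1] at key
    rw [key]
    ring
  · have hy1 : y ∈ Set.Ioo (0 : ℝ) 1 := ⟨hy.1, hy.2.trans_le hx.2⟩
    have hyI : y ∈ Set.Icc (0 : ℝ) 1 := ⟨hy1.1.le, hy1.2.le⟩
    have hw' : HasDerivAt w (ρ y) y := by
      have h := intervalIntegral.integral_hasDerivAt_right (f := ρ) (a := 0) (b := y)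
        (ContinuousOn.intervalIntegrable_of_Icc hyI.1
          (hρ.mono (Set.Icc_subset_Icc_right hyI.2)))
        ((hρ.mono Set.Ioo_subset_Icc_self).stronglyMeasurableAtFilter isOpen_Ioo y hy1)
        (hρ.continuousAt (Icc_mem_nhds hy1.1 hy1.2))
      refine h.congr_of_eventuallyEq ?_
      filter_upwards [Icc_mem_nhds hy1.1 hy1.2] with z hz using hw z hz
    have := ((hw'.ofReal_comp).const_mul c).cexp
    rwa [mul_comm] at this

include hρ hq hw

lemma integrableOn_phaseKernel (k : ℂ) (n : ℕ) :
    IntegrableOn (phaseKernel q w k n) (Set.Ioc 0 1) :=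
  (hasDensity_exp hρ hw _).integrableOn_mul (hq.ofReal.div_const 2)

lemma hasDensity_expTerm (k : ℂ) (n : ℕ) :
    HasDensity (expTerm q w k n) (fun x => Complex.I * k * (-1) ^ n * ρ x * expTerm q w k n x +
      q x / 2 * shiftRight (fun m => expTerm q w k m x) n) := by
  have he := hasDensity_exp hρ hw (Complex.I * k * (-1) ^ n)
  cases n with
  | zero =>
    refine (he.mul (HasDensity.const 1)).congr (fun x _ => rfl) fun x _ => ?_
    simp [expTerm, iteratedPrimitive, shiftRight]
  | succ n =>
    have hi := hasDensity_iteratedPrimitive (integrableOn_phaseKernel hρ hq hw k) n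
    refine (he.mul hi).congr (fun x _ => rfl) fun x _ => ?_
    have hexp : Complex.exp (Complex.I * k * (-1) ^ (n + 1) * w x) *
        Complex.exp (2 * Complex.I * k * (-1) ^ n * w x) =
        Complex.exp (Complex.I * k * (-1) ^ n * w x) := by
      rw [← Complex.exp_add]
      congr 1
      ring
    simp only [expTerm, shiftRight, phaseKernel]
    linear_combination (q x / 2 * iteratedPrimitive (phaseKernel q w k) n x : ℂ) * hexp

lemma hasDensity_sinTerm (k : ℂ) (n : ℕ) :
    HasDensity (sinTerm q w k n) (fun x => k * ρ x * cosTerm q w k n x +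
      q x / 2 * shiftRight (fun m => sinTerm q w k m x) n) := by
  refine (((hasDensity_expTerm hρ hq hw k n).add
    ((hasDensity_expTerm hρ hq hw (-k) n).const_mul (-1))).const_mul (1 / (2 * Complex.I))).congr
      (fun x _ => by simp only [sinTerm]; ring) fun x _ => ?_
  have hI := Complex.I_ne_zero
  cases n with
  | zero => simp only [shiftRight, cosTerm]; field_simp; ring
  | succ n => simp only [shiftRight, cosTerm, sinTerm]; field_simp; ring

lemma hasDensity_cosTerm (k : ℂ) (n : ℕ) :
    HasDensity (cosTerm q w k n) (fun x => -k * ρ x * sinTerm q w k n x -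
      q x / 2 * shiftRight (fun m => cosTerm q w k m x) n) := by
  refine (((hasDensity_expTerm hρ hq hw k n).add
    (hasDensity_expTerm hρ hq hw (-k) n)).const_mul ((-1) ^ n / 2)).congr
      (fun x _ => by simp only [cosTerm]; ring) fun x _ => ?_
  have hI := Complex.I_ne_zero
  have h1 : ((-1 : ℂ) ^ n) * (-1) ^ n = 1 := by rw [← mul_pow]; simp
  have key : -k * ρ x * sinTerm q w k n x = (-1) ^ n / 2 *
      (Complex.I * k * (-1) ^ n * ρ x * expTerm q w k n x +
        Complex.I * -k * (-1) ^ n * ρ x * expTerm q w (-k) n x) := by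
    simp only [sinTerm]
    field_simp
    linear_combination (-k * ρ x * (expTerm q w k n x - expTerm q w (-k) n x)) *
      (Complex.I ^ 2 * h1 + Complex.I_sq)
  rw [key]
  cases n with
  | zero => simp only [shiftRight]; ring
  | succ n => simp only [shiftRight, cosTerm, pow_succ]; ring

lemma exists_bound_expTerm (k : ℂ) : ∃ a : ℕ → ℝ, Summable a ∧ (∀ n, 0 ≤ a n) ∧
    ∀ n, ∀ x ∈ Set.Icc (0 : ℝ) 1, ‖expTerm q w k n x‖ ≤ a n := by
  obtain ⟨W, hW⟩ := isCompact_Icc.exists_bound_of_continuousOn (continuousOn_of_eq_integral hρ hw)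
  have hexp : ∀ c : ℂ, ∀ n : ℕ, ∀ x ∈ Set.Icc (0 : ℝ) 1,
      ‖Complex.exp (c * (-1) ^ n * w x)‖ ≤ Real.exp (‖c‖ * W) := by
    intro c n x hx
    refine (Complex.norm_exp_le_exp_norm _).trans (Real.exp_le_exp.2 ?_)
    rw [norm_mul, norm_mul, norm_pow, norm_neg, norm_one, one_pow, mul_one, Complex.norm_real]
    exact mul_le_mul_of_nonneg_left (hW x hx) (norm_nonneg _)
  set G : ℝ → ℝ := fun t => Real.exp (‖2 * Complex.I * k‖ * W) * (|q t| / 2) with hG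
  have hGi : IntegrableOn G (Set.Ioc 0 1) := (hq.abs.div_const 2).const_mul _
  have hG0 : ∀ t, 0 ≤ G t := fun t => by positivity
  have hle : ∀ n, ∀ x ∈ Set.Icc (0 : ℝ) 1, ‖phaseKernel q w k n x‖ ≤ G x := by
    intro n x hx
    rw [phaseKernel, norm_mul]
    have : ‖(q x / 2 : ℂ)‖ = |q x| / 2 := by simp
    rw [this]
    exact mul_le_mul_of_nonneg_right (hexp _ n x hx) (by positivity)
  have hB := norm_iteratedPrimitive_le hGi hG0 hle
  have hI0 : ∀ x, 0 ≤ ∫ t in Set.Ioc 0 x, G t := fun x => integral_nonneg hG0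
  refine ⟨fun n => Real.exp (‖Complex.I * k‖ * W) *
    ((∫ t in Set.Ioc 0 1, G t) ^ n / n.factorial),
    (Real.summable_pow_div_factorial _).mul_left _, fun n => ?_, fun n x hx => ?_⟩
  · have := hI0 1
    positivity
  · rw [expTerm, norm_mul]
    refine mul_le_mul (hexp _ n x hx) ((hB n x hx).trans ?_) (norm_nonneg _) (Real.exp_pos _).le
    have hmono : ∫ t in Set.Ioc 0 x, G t ≤ ∫ t in Set.Ioc 0 1, G t :=
      setIntegral_mono_set hGi (Eventually.of_forall hG0)
        (Set.Ioc_subset_Ioc_right hx.2).eventuallyLE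
    exact div_le_div_of_nonneg_right (pow_le_pow_left₀ (hI0 x) hmono n) (by positivity)

/-- The sums of the sine and cosine series solve the first-order system in integrated form. -/
lemma hasDensity_tsum (k : ℂ) :
    HasDensity (fun x => ∑' n, sinTerm q w k n x)
        (fun x => k * ρ x * (∑' n, cosTerm q w k n x) + q x / 2 * ∑' n, sinTerm q w k n x) ∧
      HasDensity (fun x => ∑' n, cosTerm q w k n x)
        (fun x => -k * ρ x * (∑' n, sinTerm q w k n x) - q x / 2 * ∑' n, cosTerm q w k n x) := by
  obtain ⟨a, ha, ha0, hak⟩ := exists_bound_expTerm hρ hq hw k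
  obtain ⟨a', ha', ha0', hak'⟩ := exists_bound_expTerm hρ hq hw (-k)
  set b : ℕ → ℝ := fun n => a n + a' n
  have hb : Summable b := ha.add ha'
  have hb0 : ∀ n, 0 ≤ b n := fun n => add_nonneg (ha0 n) (ha0' n)
  have hs : ∀ n, ∀ x ∈ Set.Icc (0 : ℝ) 1, ‖sinTerm q w k n x‖ ≤ b n := by
    intro n x hx
    have h := (norm_sub_le (expTerm q w k n x) (expTerm q w (-k) n x)).trans
      (add_le_add (hak n x hx) (hak' n x hx))
    simp only [sinTerm, norm_div, norm_mul, Complex.norm_I, Complex.norm_two, mul_one]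
    have := hb0 n
    linarith
  have hc : ∀ n, ∀ x ∈ Set.Icc (0 : ℝ) 1, ‖cosTerm q w k n x‖ ≤ b n := by
    intro n x hx
    have h := (norm_add_le (expTerm q w k n x) (expTerm q w (-k) n x)).trans
      (add_le_add (hak n x hx) (hak' n x hx))
    simp only [cosTerm, norm_div, norm_mul, norm_pow, norm_neg, norm_one, one_pow, one_mul,
      Complex.norm_two]
    have := hb0 n
    linarith
  set d : ℕ → ℝ := fun n => b n + b (n - 1) with hd_def
  have hd : Summable d := hb.add ((summable_nat_add_iff 1).1 (by simpa using hb))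
  have hbd : ∀ n, b n ≤ d n := fun n => le_add_of_nonneg_right (hb0 _)
  have hshift : ∀ (u : ℕ → ℂ), (∀ n, ‖u n‖ ≤ b n) → ∀ n, ‖shiftRight u n‖ ≤ d n := by
    rintro u hu (_ | n)
    · simpa [shiftRight] using (hb0 0).trans (hbd 0)
    · exact (hu n).trans (le_add_of_nonneg_left (hb0 _))
  set G : ℝ → ℝ := fun x => ‖k‖ * |ρ x| + |q x| / 2
  have hG : IntegrableOn G (Set.Ioc 0 1) :=
    ((hρ.integrableOn_Icc.mono_set Set.Ioc_subset_Icc_self).abs.const_mul _).add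
      (hq.abs.div_const 2)
  have hbound : ∀ (n : ℕ) (x : ℝ) (z v : ℂ), ‖z‖ ≤ d n → ‖v‖ ≤ d n →
      ‖k * ρ x * z‖ + ‖(q x / 2 : ℂ) * v‖ ≤ d n * G x := by
    intro n x z v hz hv
    have h1 : ‖k * ρ x * z‖ ≤ ‖k‖ * |ρ x| * d n := by
      rw [norm_mul, norm_mul, Complex.norm_real, Real.norm_eq_abs]
      exact mul_le_mul_of_nonneg_left hz (by positivity)
    have h2 : ‖(q x / 2 : ℂ) * v‖ ≤ |q x| / 2 * d n := by
      rw [norm_mul, norm_div, Complex.norm_real, Real.norm_eq_abs, Complex.norm_two]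
      exact mul_le_mul_of_nonneg_left hv (by positivity)
    calc _ ≤ _ := add_le_add h1 h2
      _ = d n * G x := by ring
  have hsumS : ∀ x ∈ Set.Icc (0 : ℝ) 1, Summable fun n => sinTerm q w k n x := fun x hx =>
    Summable.of_norm_bounded hb fun n => hs n x hx
  have hsumC : ∀ x ∈ Set.Icc (0 : ℝ) 1, Summable fun n => cosTerm q w k n x := fun x hx =>
    Summable.of_norm_bounded hb fun n => hc n x hx
  constructor
  · refine (HasDensity.tsum (hasDensity_sinTerm hρ hq hw k) hd
      (fun n x hx => (hs n x hx).trans (hbd n)) hG fun n x hx => ?_).congr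
      (fun x _ => rfl) fun x hx => ?_
    · exact (norm_add_le _ _).trans (hbound n x _ _ ((hc n x hx).trans (hbd n))
        (hshift _ (fun m => hs m x hx) n))
    · rw [((hsumC x hx).mul_left _).tsum_add ((summable_shiftRight (hsumS x hx)).mul_left _),
        _root_.tsum_mul_left, _root_.tsum_mul_left, tsum_shiftRight (hsumS x hx)]
  · refine (HasDensity.tsum (hasDensity_cosTerm hρ hq hw k) hd
      (fun n x hx => (hc n x hx).trans (hbd n)) hG fun n x hx => ?_).congr
      (fun x _ => rfl) fun x hx => ?_
    · refine (norm_sub_le _ _).trans ?_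
      rw [neg_mul, neg_mul, norm_neg]
      exact hbound n x _ _ ((hs n x hx).trans (hbd n)) (hshift _ (fun m => hc m x hx) n)
    · rw [((hsumS x hx).mul_left _).tsum_sub ((summable_shiftRight (hsumC x hx)).mul_left _),
        _root_.tsum_mul_left, _root_.tsum_mul_left, tsum_shiftRight (hsumC x hx)]

/-- Energy identity: if the sine series vanishes at `1`, then `k` is real. -/
lemma im_eq_zero_of_tsum_sinTerm_eq_zero (hρ0 : ∀ x ∈ Set.Icc (0 : ℝ) 1, 0 < ρ x) (k : ℂ)
    (hk : ∑' n, sinTerm q w k n 1 = 0) : k.im = 0 := by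
  obtain ⟨hf, hg⟩ := hasDensity_tsum hρ hq hw k
  set f : ℝ → ℂ := fun x => ∑' n, sinTerm q w k n x with hf_def
  set g : ℝ → ℂ := fun x => ∑' n, cosTerm q w k n x with hg_def
  have hw0 : w 0 = 0 := by simpa using hw 0 (by simp)
  have hterm : ∀ (c : ℂ) (n : ℕ), expTerm q w c n 0 = if n = 0 then 1 else 0 := by
    rintro c (_ | n) <;> simp [expTerm, iteratedPrimitive, hw0]
  have hf0 : f 0 = 0 := by simp [hf_def, sinTerm, hterm]
  have hg0 : g 0 = 1 := by
    simp only [hg_def, cosTerm, hterm]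
    rw [tsum_eq_single 0 (fun n hn => by simp [hn])]
    norm_num
  have hE := (hf.mul hg.conj).2 1 (by simp)
  have hf1 : f 1 = 0 := hk
  set N : ℝ → ℝ := fun x => ρ x * (Complex.normSq (g x) + Complex.normSq (f x)) with hN
  have hdens := (hf.mul hg.conj).1
  beta_reduce at hE hdens
  rw [hf1, hf0, zero_mul, zero_mul, zero_add] at hE
  have him : ∀ x, (((k * ρ x * g x + q x / 2 * f x) * (starRingEnd ℂ) (g x) +
      f x * (starRingEnd ℂ) (-k * ρ x * f x - q x / 2 * g x)) : ℂ).im = k.im * N x := by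
    intro x
    have : ((k * ρ x * g x + q x / 2 * f x) * (starRingEnd ℂ) (g x) +
        f x * (starRingEnd ℂ) (-k * ρ x * f x - q x / 2 * g x)) =
        k * (ρ x * Complex.normSq (g x) : ℝ) -
          (starRingEnd ℂ) k * (ρ x * Complex.normSq (f x) : ℝ) := by
      simp only [map_sub, map_mul, map_neg, map_div₀, Complex.conj_ofReal, map_ofNat]
      push_cast [Complex.normSq_eq_conj_mul_self]
      ring
    rw [this, Complex.sub_im, Complex.im_mul_ofReal, Complex.im_mul_ofReal, Complex.conj_im]
    simp only [hN]
    ring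
  have hzero : k.im * ∫ x in Set.Ioc (0 : ℝ) 1, N x = 0 := by
    rw [← integral_const_mul]
    simp only [← him]
    have := integral_im hdens
    simp only [RCLike.im_to_complex] at this
    rw [this, ← hE, Complex.zero_im]
  have hpos : 0 < ∫ x in (0 : ℝ)..1, N x := by
    refine intervalIntegral.integral_pos one_pos ?_ (fun x hx => ?_) ⟨0, by simp, ?_⟩
    · exact hρ.mul ((Complex.continuous_normSq.comp_continuousOn hg.continuousOn).add
        (Complex.continuous_normSq.comp_continuousOn hf.continuousOn))
    · exact mul_nonneg (hρ0 x ⟨hx.1.le, hx.2⟩).le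
        (add_nonneg (Complex.normSq_nonneg _) (Complex.normSq_nonneg _))
    · simp [hN, hf0, hg0, hρ0 0]
  rw [intervalIntegral.integral_of_le zero_le_one] at hpos
  exact (mul_eq_zero.1 hzero).resolve_right hpos.ne'

end Series

section Phase
variable {σ : ℝ → ℝ}

lemma sum_alternating_sub (u : ℕ → ℝ) (n : ℕ) :
    ∑ p ∈ Finset.range (n + 1), (-1 : ℝ) ^ p * (u (p + 1) - u p) =
      (-1) ^ n * u (n + 1) - u 0 + 2 * ∑ i ∈ Finset.range n, (-1) ^ i * u (i + 1) := by
  induction n with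
  | zero => simp
  | succ n ih =>
    rw [Finset.sum_range_succ, ih, Finset.sum_range_succ _ n]
    ring

lemma phase_eq (hρ : ContinuousOn (fun x => 1 / σ x) (Set.Icc 0 1)) {n : ℕ} {y : Fin n → ℝ}
    (hy : y ∈ simplex 0 1 n) :
    phase σ 0 1 n y = (-1) ^ n * (∫ ξ in (0 : ℝ)..1, 1 / σ ξ) +
      2 * ∑ i : Fin n, (-1) ^ (i : ℕ) * ∫ ξ in (0 : ℝ)..(y i), 1 / σ ξ := by
  have hmem : ∀ p, nodes 0 1 n y p ∈ Set.Icc (0 : ℝ) 1 := by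
    intro p
    unfold nodes
    split_ifs
    · exact hy.2 _
    · simp
    · simp
  have hint : ∀ x ∈ Set.Icc (0 : ℝ) 1, IntervalIntegrable (fun x => 1 / σ x) volume 0 x :=
    fun x hx => ContinuousOn.intervalIntegrable_of_Icc hx.1
      (hρ.mono (Set.Icc_subset_Icc_right hx.2))
  have h := sum_alternating_sub (fun p => ∫ ξ in (0 : ℝ)..(nodes 0 1 n y p), 1 / σ ξ) n
  have h0 : nodes 0 1 n y 0 = 0 := by simp [nodes]
  have h1 : nodes 0 1 n y (n + 1) = 1 := by simp [nodes]
  simp only [h0, h1, intervalIntegral.integral_same, sub_zero] at h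
  rw [Finset.sum_range (n := n)] at h
  have hi : ∀ i : Fin n, nodes 0 1 n y (i + 1) = y i := fun i => by
    have : (i : ℕ) + 1 ≤ n := i.2
    simp [nodes, this]
  simp only [hi] at h
  rw [phase, ← h]
  refine Finset.sum_congr rfl fun p _ => ?_
  rw [intervalIntegral.integral_interval_sub_left (hint _ (hmem _)) (hint _ (hmem _))]

lemma S_eq_sinTerm (hρ : ContinuousOn (fun x => 1 / σ x) (Set.Icc 0 1))
    (hq : IntegrableOn (fun t => deriv σ t / σ t) (Set.Ioc 0 1)) (n : ℕ) (k : ℂ) :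
    S σ 0 1 n k = sinTerm (fun t => deriv σ t / σ t)
      (fun x => ∫ ξ in (0 : ℝ)..x, 1 / σ ξ) k n 1 := by
  set q : ℝ → ℝ := fun t => deriv σ t / σ t with hq_def
  set w : ℝ → ℝ := fun x => ∫ ξ in (0 : ℝ)..x, 1 / σ ξ with hw_def
  have hr := integrableOn_phaseKernel hρ hq (w := w) (fun x _ => rfl)
  have hprod : ∀ (c : ℂ) (y : Fin n → ℝ), y ∈ simplex 0 1 n →
      Complex.exp (Complex.I * c * (-1) ^ n * w 1) * ∏ i : Fin n, phaseKernel q w c i (y i) =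
        ((2 : ℂ) ^ n)⁻¹ * (((∏ p, q (y p) : ℝ) : ℂ) *
          Complex.exp (c * (phase σ 0 1 n y : ℝ) * Complex.I)) := by
    intro c y hy
    simp only [phaseKernel]
    rw [Finset.prod_mul_distrib, ← Complex.exp_sum, Finset.prod_div_distrib, ← mul_assoc,
      ← Complex.exp_add, phase_eq hρ hy]
    have : Complex.I * c * (-1) ^ n * (w 1 : ℂ) +
        ∑ i : Fin n, 2 * Complex.I * c * (-1) ^ (i : ℕ) * (w (y i) : ℂ) =
        c * (((-1) ^ n * w 1 + 2 * ∑ i : Fin n, (-1) ^ (i : ℕ) * w (y i) : ℝ) : ℂ) *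
          Complex.I := by
      push_cast
      rw [Finset.mul_sum, mul_add, add_mul, Finset.mul_sum, Finset.sum_mul]
      congr 1
      · ring
      · exact Finset.sum_congr rfl fun i _ => by ring
    rw [this]
    push_cast
    simp only [Finset.prod_const, Finset.card_univ, Fintype.card_fin]
    ring
  rw [S, sinTerm, expTerm, expTerm, ← setIntegral_simplex_prod (hr k) n le_rfl,
    ← setIntegral_simplex_prod (hr (-k)) n le_rfl, ← integral_const_mul, ← integral_const_mul,
    ← integral_const_mul, ← integral_sub
      ((integrableOn_simplex_prod (hr k) n le_rfl).const_mul _)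
      ((integrableOn_simplex_prod (hr (-k)) n le_rfl).const_mul _), ← integral_div]
  refine setIntegral_congr_fun (measurableSet_simplex _ _ _) fun y hy => ?_
  rw [hprod k y hy, hprod (-k) y hy, Sintegrand, Complex.sin, neg_mul, neg_mul]
  have hI := Complex.I_ne_zero
  field_simp
  rw [Complex.I_sq]
  ring

end Phase

/-- Every zero of `Δ` is real. -/
theorem stmt_5 (σ : ℝ → ℝ)
    (hσpos : ∀ x ∈ Set.Icc (0 : ℝ) 1, 0 < σ x)
    (hσAC : sigmaAC σ)
    (hratio : IntegrableOn (fun t => deriv σ t / σ t) (Set.Ioo 0 1))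
    (k : ℂ) (hk : Δfun σ k = 0) : k.im = 0 := by
  have hσc : ContinuousOn σ (Set.Icc 0 1) := by
    have hp : ContinuousOn (fun x => ∫ t in Set.Ioc 0 x, deriv σ t) (Set.Icc 0 1) :=
      intervalIntegral.continuousOn_primitive hσAC.1
    refine ((continuousOn_const (c := σ 0)).add hp).congr fun x hx => ?_
    rw [hσAC.2 x hx, intervalIntegral.integral_of_le hx.1]
    rfl
  have hρ : ContinuousOn (fun x => 1 / σ x) (Set.Icc 0 1) :=
    continuousOn_const.div hσc fun x hx => (hσpos x hx).ne'
  have hq : IntegrableOn (fun t => deriv σ t / σ t) (Set.Ioc 0 1) :=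
    (integrableOn_Ioc_iff_integrableOn_Ioo).2 hratio
  refine im_eq_zero_of_tsum_sinTerm_eq_zero hρ hq (w := fun x => ∫ ξ in (0 : ℝ)..x, 1 / σ ξ)
    (fun x _ => rfl) (fun x hx => one_div_pos.2 (hσpos x hx)) k ?_
  rw [← hk, Δfun]
  exact tsum_congr fun n => (S_eq_sinTerm hρ hq n k).symm
end
end
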